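/- arXiv:2412.03207 — 5 statements merged into one kernel-verified Lean document; each statement's English description precedes it below -/
import Mathlib

section
/- Let G ∼ D(n,p) be the directed Erdős–Rényi random graph with condescendence parameters α_i and initial opinions x(0) ∈ [0,1]^n. Suppose the Assumption holds (there exists ᾱ ∈ (0,1) such that for all n and every i ∈ [n], α_i ≤ ᾱ) and that p ≫ log(n)²/n. Then for every ρ ∈ (1,∞), ‖E(x(G,∞)) − x̄(∞)‖_ρ → 0 as n → ∞, where ‖y‖_ρ = (Σ_{i=1}^n |y_i|^ρ)^{1/ρ}, x(G,∞) is the stable opinion of the directed opinion dynamics on G, and x̄(∞) = (I − E(H(G)))^{−1}Bx(0). -/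
open Finset Filter Topology Matrix

attribute [local instance] Classical.propDecidable

noncomputable section

/-- The set of possible directed edges of a simple directed graph on `Fin n`:
all ordered pairs `(i,j)` with `i ≠ j`.  A directed graph `G ∈ 𝔻ₙ` is
identified with its edge set, a subset of `allDirEdges n`. -/
def allDirEdges (n : ℕ) : Finset (Fin n × Fin n) :=
  Finset.univ.filter fun e => e.1 ≠ e.2

/-- Probability weight of a given edge set in the directed Erdős–Rényi model
`D(n,p)`. -/
def dProb (n : ℕ) (p : ℝ) (E : Finset (Fin n × Fin n)) : ℝ :=
  p ^ E.card * (1 - p) ^ ((allDirEdges n).card - E.card)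

/-- Expectation of a real random variable in the directed Erdős–Rényi model
`D(n,p)`. -/
def dExp (n : ℕ) (p : ℝ) (X : Finset (Fin n × Fin n) → ℝ) : ℝ :=
  ∑ E ∈ (allDirEdges n).powerset, dProb n p E * X E

/-- Out-degree of the node `i` in the directed graph with edge set `E`. -/
def degPlus (n : ℕ) (E : Finset (Fin n × Fin n)) (i : Fin n) : ℕ :=
  (Finset.univ.filter fun j => j ≠ i ∧ (i, j) ∈ E).card

/-- Truncated inverse out-degree `f_i`. -/
def finvD (n : ℕ) (E : Finset (Fin n × Fin n)) (i : Fin n) : ℝ :=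
  if degPlus n E i = 0 then 0 else 1 / (degPlus n E i : ℝ)

/-- The opinion-dynamics matrix `H(G)` of a directed graph, with condescendence
parameters `α`. -/
def HmatD (n : ℕ) (α : Fin n → ℝ) (E : Finset (Fin n × Fin n)) : Matrix (Fin n) (Fin n) ℝ :=
  Matrix.of fun i j =>
    if degPlus n E i = 0 then (if i = j then α i else 0)
    else if i ≠ j ∧ (i, j) ∈ E then α i / (degPlus n E i : ℝ) else 0

/-- Entrywise expectation of a random matrix in the directed Erdős–Rényi model
`D(n,p)`. -/
def dExpMat (n : ℕ) (p : ℝ) (M : Finset (Fin n × Fin n) → Matrix (Fin n) (Fin n) ℝ) :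
    Matrix (Fin n) (Fin n) ℝ :=
  Matrix.of fun i j => dExp n p fun E => M E i j

/-- Conditional expectation `E(X | A)` given an event `A`. -/
def dCondExp (n : ℕ) (p : ℝ) (X : Finset (Fin n × Fin n) → ℝ)
    (A : Finset (Fin n × Fin n) → Prop) : ℝ :=
  dExp n p (fun E => if A E then X E else 0) / dExp n p (fun E => if A E then 1 else 0)

/-- The matrix norm `‖M‖_* = max_i Σ_j |M i j|` induced by the `ℓ∞` norm. -/
def starNorm {n : ℕ} (M : Matrix (Fin n) (Fin n) ℝ) : ℝ :=
  ⨆ i, ∑ j, |M i j|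

/-- The opinion-dynamics iterates `x(G,t)`: `x(G,0) = x0`,
`x(G,t+1) = H x(G,t) + B x0`. -/
def dynD (n : ℕ) (H B : Matrix (Fin n) (Fin n) ℝ) (x0 : Fin n → ℝ) : ℕ → Fin n → ℝ
  | 0 => x0
  | t + 1 => H *ᵥ dynD n H B x0 t + B *ᵥ x0

/-! ### Expectations under independent edge percolation -/

/-- Expectation over a random subset of `A` containing each element independently with
probability `p`. -/
def percExp {β : Type*} (p : ℝ) (A : Finset β) (X : Finset β → ℝ) : ℝ :=
  ∑ E ∈ A.powerset, p ^ E.card * (1 - p) ^ (A.card - E.card) * X E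

theorem dExp_eq_percExp (n : ℕ) (p : ℝ) (X : Finset (Fin n × Fin n) → ℝ) :
    dExp n p X = percExp p (allDirEdges n) X := rfl

theorem percExp_const {β : Type*} (p : ℝ) (A : Finset β) (c : ℝ) :
    percExp p A (fun _ => c) = c := by
  rw [percExp, ← Finset.sum_mul, Finset.sum_pow_mul_eq_add_pow]
  simp

theorem percExp_disjUnion {β : Type*} [DecidableEq β] (p : ℝ) {A B : Finset β} (h : Disjoint A B)
    (X : Finset β → ℝ) :
    percExp p (A ∪ B) X = percExp p A (fun E => percExp p B (fun F => X (E ∪ F))) := by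
  simp only [percExp, Finset.mul_sum]
  rw [← Finset.sum_product']
  refine Finset.sum_nbij' (fun E => (E ∩ A, E ∩ B)) (fun q => q.1 ∪ q.2) ?_ ?_ ?_ ?_ ?_
  · intro E _
    simp
  · rintro ⟨E, F⟩ hq
    simp only [Finset.mem_product, Finset.mem_powerset] at hq ⊢
    exact Finset.union_subset_union hq.1 hq.2
  · intro E hE
    rw [← Finset.inter_union_distrib_left]
    exact Finset.inter_eq_left.2 (Finset.mem_powerset.1 hE)
  · rintro ⟨E, F⟩ hq
    simp only [Finset.mem_product, Finset.mem_powerset] at hq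
    have h1 : F ∩ A = ∅ := Finset.disjoint_iff_inter_eq_empty.1
      (h.symm.mono_left hq.2)
    have h2 : E ∩ B = ∅ := Finset.disjoint_iff_inter_eq_empty.1 (h.mono_left hq.1)
    simp [Finset.union_inter_distrib_right, h1, h2, Finset.inter_eq_left.2 hq.1,
      Finset.inter_eq_left.2 hq.2]
  · intro E hE
    have hE' : E ∩ A ∪ E ∩ B = E := by
      rw [← Finset.inter_union_distrib_left]
      exact Finset.inter_eq_left.2 (Finset.mem_powerset.1 hE)
    have hc : E.card = (E ∩ A).card + (E ∩ B).card := by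
      rw [← Finset.card_union_of_disjoint, hE']
      exact h.mono Finset.inter_subset_right Finset.inter_subset_right
    have hA : (E ∩ A).card ≤ A.card := Finset.card_le_card Finset.inter_subset_right
    have hB : (E ∩ B).card ≤ B.card := Finset.card_le_card Finset.inter_subset_right
    have he : (A ∪ B).card - E.card
        = (A.card - (E ∩ A).card) + (B.card - (E ∩ B).card) := by
      rw [Finset.card_union_of_disjoint h]
      omega
    simp only [hE']
    rw [he, hc, pow_add, pow_add]
    ring

theorem percExp_mul_const {β : Type*} (p : ℝ) (A : Finset β) (X : Finset β → ℝ) (c : ℝ) :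
    percExp p A (fun E => X E * c) = percExp p A X * c := by
  simp only [percExp, Finset.sum_mul, mul_assoc]

theorem percExp_const_mul {β : Type*} (p : ℝ) (A : Finset β) (X : Finset β → ℝ) (c : ℝ) :
    percExp p A (fun E => c * X E) = c * percExp p A X := by
  simp only [mul_comm c, percExp_mul_const]

theorem percExp_mul_of_disjoint {β : Type*} [DecidableEq β] (p : ℝ) {A B C : Finset β} (h : Disjoint A B)
    (hC : A ∪ B = C) {X Y : Finset β → ℝ}
    (hX : ∀ E F, E ⊆ A → F ⊆ B → X (E ∪ F) = X E)
    (hY : ∀ E F, E ⊆ A → F ⊆ B → Y (E ∪ F) = Y F) :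
    percExp p C (fun E => X E * Y E) = percExp p C X * percExp p C Y := by
  subst hC
  have congr₂ : ∀ Z Z' : Finset β → Finset β → ℝ,
      (∀ E F, E ⊆ A → F ⊆ B → Z E F = Z' E F) →
      percExp p A (fun E => percExp p B (Z E)) = percExp p A (fun E => percExp p B (Z' E)) := by
    intro Z Z' hZ
    refine Finset.sum_congr rfl fun E hE => ?_
    congr 1
    refine Finset.sum_congr rfl fun F hF => ?_
    rw [hZ E F (Finset.mem_powerset.1 hE) (Finset.mem_powerset.1 hF)]
  rw [percExp_disjUnion p h, percExp_disjUnion p h, percExp_disjUnion p h,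
    congr₂ _ (fun E F => X E * Y F) fun E F hE hF => by rw [hX E F hE hF, hY E F hE hF],
    congr₂ _ (fun E _ => X E) hX, congr₂ _ (fun _ F => Y F) hY]
  simp only [percExp_const, percExp_const_mul, percExp_mul_const]

theorem percExp_mono {β : Type*} {p : ℝ} (hp : p ∈ Set.Icc (0 : ℝ) 1) (A : Finset β)
    {X Y : Finset β → ℝ} (h : ∀ E, X E ≤ Y E) : percExp p A X ≤ percExp p A Y := by
  have h1 : 0 ≤ 1 - p := sub_nonneg.2 hp.2
  refine Finset.sum_le_sum fun E _ => mul_le_mul_of_nonneg_left (h E) ?_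
  exact mul_nonneg (pow_nonneg hp.1 _) (pow_nonneg h1 _)

theorem percExp_sum {β ι : Type*} (p : ℝ) (A : Finset β) (s : Finset ι)
    (X : ι → Finset β → ℝ) :
    percExp p A (fun E => ∑ j ∈ s, X j E) = ∑ j ∈ s, percExp p A (X j) := by
  simp only [percExp, Finset.mul_sum]
  exact Finset.sum_comm

/-- The probability that a random subset of `A` misses `R ⊆ A`. -/
theorem percExp_disjoint {β : Type*} [DecidableEq β] (p : ℝ) {A R : Finset β} (hR : R ⊆ A) :
    percExp p A (fun E => if E ∩ R = ∅ then 1 else 0) = (1 - p) ^ R.card := by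
  have hd : Disjoint R (A \ R) := Finset.disjoint_sdiff
  conv_lhs => rw [← Finset.union_sdiff_of_subset hR, percExp_disjUnion p hd]
  have : ∀ E ∈ R.powerset,
      p ^ E.card * (1 - p) ^ (R.card - E.card) *
        percExp p (A \ R) (fun F => if (E ∪ F) ∩ R = ∅ then (1 : ℝ) else 0)
      = if E = ∅ then (1 - p) ^ R.card else 0 := by
    intro E hE
    have hE' := Finset.mem_powerset.1 hE
    have h2 : percExp p (A \ R) (fun F => if (E ∪ F) ∩ R = ∅ then (1 : ℝ) else 0)
        = percExp p (A \ R) (fun _ => if E = ∅ then (1 : ℝ) else 0) := by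
      refine Finset.sum_congr rfl fun F hF => ?_
      have h3 : F ∩ R = ∅ := Finset.disjoint_iff_inter_eq_empty.1
        (hd.symm.mono_left (Finset.mem_powerset.1 hF))
      simp only [Finset.union_inter_distrib_right, h3, Finset.union_empty,
        Finset.inter_eq_left.2 hE']
    rw [h2, percExp_const]
    split_ifs with h
    · simp [h]
    · simp
  rw [percExp, Finset.sum_congr rfl this, Finset.sum_ite_eq']
  simp

theorem percExp_map {β : Type*} (p : ℝ) (A : Finset β) (σ : Equiv.Perm β)
    (hσ : A.map σ.toEmbedding = A) (X : Finset β → ℝ) :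
    percExp p A (fun E => X (E.map σ.toEmbedding)) = percExp p A X := by
  refine Finset.sum_nbij' (fun E => E.map σ.toEmbedding) (fun E => E.map σ.symm.toEmbedding)
    ?_ ?_ ?_ ?_ ?_
  · intro E hE
    rw [Finset.mem_powerset] at hE ⊢
    rw [← hσ]
    exact Finset.map_subset_map.2 hE
  · intro E hE
    rw [Finset.mem_powerset] at hE ⊢
    intro x hx
    obtain ⟨y, hy, rfl⟩ := Finset.mem_map.1 hx
    have hy' := hE hy
    rw [← hσ] at hy'
    obtain ⟨z, hz, rfl⟩ := Finset.mem_map.1 hy'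
    simpa using hz
  · intro E _
    ext x
    simp
  · intro E _
    ext x
    simp
  · intro E _
    simp

/-! ### The random matrix `H(G)` and its mean -/

theorem HmatD_nonneg {n : ℕ} {α : Fin n → ℝ} (hα : ∀ i, 0 ≤ α i)
    (E : Finset (Fin n × Fin n)) (i j : Fin n) : 0 ≤ HmatD n α E i j := by
  simp only [HmatD, Matrix.of_apply]
  split_ifs
  · exact hα i
  · exact le_rfl
  · exact div_nonneg (hα i) (Nat.cast_nonneg _)
  · exact le_rfl

theorem sum_HmatD {n : ℕ} (α : Fin n → ℝ) (E : Finset (Fin n × Fin n)) (i : Fin n) :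
    ∑ j, HmatD n α E i j = α i := by
  simp only [HmatD, Matrix.of_apply]
  by_cases h : degPlus n E i = 0
  · simp [h]
  · simp only [h, if_false]
    rw [← Finset.sum_filter, Finset.sum_const, nsmul_eq_mul]
    have : (Finset.univ.filter fun j => i ≠ j ∧ (i, j) ∈ E).card = degPlus n E i := by
      simp only [degPlus, ne_comm]
    rw [this]
    have h0 : (degPlus n E i : ℝ) ≠ 0 := Nat.cast_ne_zero.2 h
    field_simp

/-- The potential edges leaving `i`. -/
def outEdges (n : ℕ) (i : Fin n) : Finset (Fin n × Fin n) :=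
  (allDirEdges n).filter fun e => e.1 = i

theorem mem_outEdges {n : ℕ} {i : Fin n} {e : Fin n × Fin n} :
    e ∈ outEdges n i ↔ e.1 ≠ e.2 ∧ e.1 = i := by
  simp [outEdges, allDirEdges]

theorem card_outEdges (n : ℕ) (i : Fin n) : (outEdges n i).card = n - 1 := by
  have : outEdges n i = (Finset.univ.erase i).map ⟨fun j => (i, j), Prod.mk_right_injective i⟩ := by
    ext ⟨a, b⟩
    simp only [mem_outEdges, Finset.mem_map, Finset.mem_erase, Finset.mem_univ, and_true,
      Function.Embedding.coeFn_mk, Prod.mk.injEq, exists_eq_right_right]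
    grind
  rw [this, Finset.card_map, Finset.card_erase_of_mem (Finset.mem_univ _), Finset.card_univ,
    Fintype.card_fin]

theorem degPlus_eq_zero_iff {n : ℕ} (E : Finset (Fin n × Fin n)) (i : Fin n) :
    degPlus n E i = 0 ↔ E ∩ outEdges n i = ∅ := by
  simp only [degPlus, Finset.card_eq_zero, Finset.eq_empty_iff_forall_notMem, Finset.mem_filter,
    Finset.mem_univ, true_and, Finset.mem_inter, mem_outEdges]
  constructor
  · rintro h ⟨a, b⟩ ⟨hE, hne, rfl⟩
    exact h b ⟨fun hb => hne hb.symm, hE⟩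
  · rintro h j ⟨hne, hE⟩
    exact h (i, j) ⟨hE, hne.symm, rfl⟩

theorem HmatD_congr_row {n : ℕ} (α : Fin n → ℝ) {E F : Finset (Fin n × Fin n)} {i : Fin n}
    (h : ∀ j, j ≠ i → ((i, j) ∈ E ↔ (i, j) ∈ F)) (j : Fin n) :
    HmatD n α E i j = HmatD n α F i j := by
  have hd : degPlus n E i = degPlus n F i := by
    simp only [degPlus]
    congr 1
    ext j
    simp only [Finset.mem_filter, Finset.mem_univ, true_and]
    exact and_congr_right (h j)
  simp only [HmatD, Matrix.of_apply, hd]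
  by_cases hij : i = j
  · simp [hij]
  · simp [hij, h j (Ne.symm hij)]

theorem dExp_HmatD_mul {n : ℕ} (p : ℝ) (α : Fin n → ℝ) (i j : Fin n)
    {Y : Finset (Fin n × Fin n) → ℝ}
    (hY : ∀ E F, (∀ k l, k ≠ i → ((k, l) ∈ E ↔ (k, l) ∈ F)) → Y E = Y F) :
    dExp n p (fun E => HmatD n α E i j * Y E) = dExpMat n p (HmatD n α) i j * dExp n p Y := by
  have hR : outEdges n i ⊆ allDirEdges n := Finset.filter_subset _ _
  refine percExp_mul_of_disjoint p Finset.disjoint_sdiff (Finset.union_sdiff_of_subset hR)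
    (X := fun E => HmatD n α E i j) (fun E F _ hF => ?_) (fun E F hE _ => ?_)
  · refine HmatD_congr_row α (fun l hl => ?_) j
    have : (i, l) ∉ F := fun h =>
      (Finset.mem_sdiff.1 (hF h)).2 (mem_outEdges.2 ⟨hl.symm, rfl⟩)
    rw [Finset.mem_union, or_iff_left this]
  · refine hY _ _ fun k l hk => ?_
    have : (k, l) ∉ E := fun h => hk (mem_outEdges.1 (hE h)).2
    rw [Finset.mem_union, or_iff_right this]

theorem dExp_mono {n : ℕ} {p : ℝ} (hp : p ∈ Set.Icc (0 : ℝ) 1)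
    {X Y : Finset (Fin n × Fin n) → ℝ} (h : ∀ E, X E ≤ Y E) : dExp n p X ≤ dExp n p Y :=
  percExp_mono hp _ h

theorem dExp_const (n : ℕ) (p c : ℝ) : dExp n p (fun _ => c) = c := percExp_const _ _ _

theorem dExpMat_HmatD_nonneg {n : ℕ} {p : ℝ} (hp : p ∈ Set.Icc (0 : ℝ) 1) {α : Fin n → ℝ}
    (hα : ∀ i, 0 ≤ α i) (i j : Fin n) : 0 ≤ dExpMat n p (HmatD n α) i j := by
  rw [← dExp_const n p 0]
  exact dExp_mono hp fun E => HmatD_nonneg hα E i j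

theorem sum_dExpMat_HmatD {n : ℕ} (p : ℝ) (α : Fin n → ℝ) (i : Fin n) :
    ∑ j, dExpMat n p (HmatD n α) i j = α i := by
  simp only [dExpMat, Matrix.of_apply, dExp_eq_percExp]
  rw [← percExp_sum]
  simp only [sum_HmatD, percExp_const]

theorem dExpMat_HmatD_diag {n : ℕ} (p : ℝ) (α : Fin n → ℝ) (i : Fin n) :
    dExpMat n p (HmatD n α) i i = α i * (1 - p) ^ (n - 1) := by
  have hR : outEdges n i ⊆ allDirEdges n := Finset.filter_subset _ _
  rw [← card_outEdges n i, ← percExp_disjoint p hR, ← percExp_const_mul]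
  simp only [dExpMat, Matrix.of_apply, dExp_eq_percExp]
  congr 1
  funext E
  simp only [HmatD, Matrix.of_apply, degPlus_eq_zero_iff, ne_eq, not_true_eq_false, false_and,
    if_true, if_false]
  split_ifs <;> simp

theorem dExpMat_HmatD_swap {n : ℕ} (p : ℝ) (α : Fin n → ℝ) {i j k : Fin n} (hj : j ≠ i)
    (hk : k ≠ i) : dExpMat n p (HmatD n α) i j = dExpMat n p (HmatD n α) i k := by
  set τ : Equiv.Perm (Fin n) := Equiv.swap j k
  have hτi : τ i = i := Equiv.swap_apply_of_ne_of_ne hj.symm hk.symm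
  have hτk : τ k = j := Equiv.swap_apply_right j k
  set σ : Equiv.Perm (Fin n × Fin n) := τ.prodCongr τ
  have hmem : ∀ (E : Finset (Fin n × Fin n)) (a b : Fin n),
      (τ a, τ b) ∈ E.map σ.toEmbedding ↔ (a, b) ∈ E := by
    intro E a b
    exact Finset.mem_map' (f := σ.toEmbedding) (a := (a, b)) (s := E)
  have hσ : (allDirEdges n).map σ.toEmbedding = allDirEdges n := by
    ext ⟨a, b⟩
    obtain ⟨a, rfl⟩ := τ.surjective a
    obtain ⟨b, rfl⟩ := τ.surjective b
    rw [hmem]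
    simp [allDirEdges]
  simp only [dExpMat, Matrix.of_apply, dExp_eq_percExp]
  rw [← percExp_map p _ σ hσ]
  congr 1
  funext E
  have hd : degPlus n (E.map σ.toEmbedding) i = degPlus n E i := by
    symm
    refine Finset.card_bij (fun a _ => τ a) ?_ (fun _ _ _ _ h => τ.injective h) ?_
    · intro a ha
      simp only [Finset.mem_filter, Finset.mem_univ, true_and] at ha ⊢
      refine ⟨fun h => ha.1 (τ.injective (h.trans hτi.symm)), ?_⟩
      have := (hmem E i a).2 ha.2
      rwa [hτi] at this
    · intro b hb
      obtain ⟨a, rfl⟩ := τ.surjective b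
      simp only [Finset.mem_filter, Finset.mem_univ, true_and] at hb
      refine ⟨a, ?_, rfl⟩
      simp only [Finset.mem_filter, Finset.mem_univ, true_and]
      refine ⟨fun h => hb.1 (by rw [h, hτi]), ?_⟩
      rw [← hmem E i a, hτi]
      exact hb.2
  have he : (i, j) ∈ E.map σ.toEmbedding ↔ (i, k) ∈ E := by
    rw [← hmem E i k, hτi, hτk]
  simp only [HmatD, Matrix.of_apply, hd, he, hj.symm, hk.symm, if_false, ne_eq, not_false_eq_true,
    true_and]

theorem dExpMat_HmatD_le {n : ℕ} (hn : 2 ≤ n) {p : ℝ} (hp : p ∈ Set.Icc (0 : ℝ) 1)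
    {α : Fin n → ℝ} {a : ℝ} (hα : ∀ i, 0 ≤ α i) (ha : ∀ i, α i ≤ a) (i j : Fin n) :
    dExpMat n p (HmatD n α) i j ≤ a * (1 / ((n : ℝ) - 1) + (1 - p) ^ (n - 1)) := by
  have hq : 0 ≤ (1 - p) ^ (n - 1) := pow_nonneg (sub_nonneg.2 hp.2) _
  have hn1 : (0 : ℝ) < (n : ℝ) - 1 := by
    have : (2 : ℝ) ≤ n := by exact_mod_cast hn
    linarith
  have ha0 : 0 ≤ a := (hα i).trans (ha i)
  rw [mul_add]
  by_cases hij : j = i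
  · subst hij
    rw [dExpMat_HmatD_diag]
    have h1 : α j * (1 - p) ^ (n - 1) ≤ a * (1 - p) ^ (n - 1) :=
      mul_le_mul_of_nonneg_right (ha j) hq
    have h2 : 0 ≤ a * (1 / ((n : ℝ) - 1)) := by positivity
    linarith
  · have hsum : ((n : ℝ) - 1) * dExpMat n p (HmatD n α) i j ≤ α i := by
      rw [← sum_dExpMat_HmatD p α i, ← Finset.add_sum_erase _ _ (Finset.mem_univ i)]
      have : ∑ k ∈ Finset.univ.erase i, dExpMat n p (HmatD n α) i k
          = ((n : ℝ) - 1) * dExpMat n p (HmatD n α) i j := by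
        rw [Finset.sum_congr rfl fun k hk =>
          dExpMat_HmatD_swap p α (Finset.ne_of_mem_erase hk) hij, Finset.sum_const,
          Finset.card_erase_of_mem (Finset.mem_univ _), Finset.card_univ, Fintype.card_fin,
          nsmul_eq_mul, Nat.cast_sub (by omega), Nat.cast_one]
      rw [this]
      linarith [dExpMat_HmatD_nonneg hp hα i i]
    have h1 : dExpMat n p (HmatD n α) i j ≤ a * (1 / ((n : ℝ) - 1)) := by
      rw [mul_one_div, le_div_iff₀ hn1, mul_comm]
      exact hsum.trans (ha i)
    have h2 : 0 ≤ a * (1 - p) ^ (n - 1) := mul_nonneg ha0 hq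
    linarith

/-! ### Walks stopped at their first repetition -/

/-- Total weight of the walks of length `t` from `i` that are stopped on reaching the set `S` or a
vertex visited before: a walk stopped with `t` steps remaining contributes `c t`, and a walk of full
length ending in `j` contributes `b j`. -/
def stoppedWalk {n : ℕ} (c : ℕ → ℝ) (b : Fin n → ℝ) (H : Matrix (Fin n) (Fin n) ℝ) :
    ℕ → Finset (Fin n) → Fin n → ℝ
  | 0, _, i => b i
  | t + 1, S, i =>
    if i ∈ S then c (t + 1) else ∑ j, H i j * stoppedWalk c b H t (insert i S) j

theorem stoppedWalk_congr {n : ℕ} (c : ℕ → ℝ) (b : Fin n → ℝ) {H H' : Matrix (Fin n) (Fin n) ℝ}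
    (t : ℕ) (S : Finset (Fin n)) (h : ∀ i, i ∉ S → ∀ j, H i j = H' i j) (i : Fin n) :
    stoppedWalk c b H t S i = stoppedWalk c b H' t S i := by
  induction t generalizing S i with
  | zero => rfl
  | succ t ih =>
    simp only [stoppedWalk]
    split_ifs with hi
    · rfl
    · refine Finset.sum_congr rfl fun j _ => ?_
      rw [h i hi j, ih (insert i S) fun k hk => h k fun hk' => hk (Finset.mem_insert_of_mem hk')]

theorem dExp_stoppedWalk {n : ℕ} (p : ℝ) (α : Fin n → ℝ) (c : ℕ → ℝ) (b : Fin n → ℝ)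
    (t : ℕ) (S : Finset (Fin n)) (i : Fin n) :
    dExp n p (fun E => stoppedWalk c b (HmatD n α E) t S i)
      = stoppedWalk c b (dExpMat n p (HmatD n α)) t S i := by
  induction t generalizing S i with
  | zero => exact dExp_const n p _
  | succ t ih =>
    simp only [stoppedWalk]
    split_ifs with hi
    · exact dExp_const n p _
    · rw [dExp_eq_percExp, percExp_sum]
      refine Finset.sum_congr rfl fun j _ => ?_
      rw [← ih, ← dExp_eq_percExp]
      refine dExp_HmatD_mul p α i j fun E F hEF => ?_
      refine stoppedWalk_congr c b t _ (fun k hk l => ?_) j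
      have hki : k ≠ i := fun h => hk (h ▸ Finset.mem_insert_self i S)
      exact HmatD_congr_row α (fun l _ => hEF k l hki) l

section Substochastic

variable {n : ℕ} {H : Matrix (Fin n) (Fin n) ℝ} {a : ℝ} {b : Fin n → ℝ}

theorem pow_succ_mulVec_apply (H : Matrix (Fin n) (Fin n) ℝ) (b : Fin n → ℝ) (t : ℕ) (i : Fin n) :
    (H ^ (t + 1) *ᵥ b) i = ∑ j, H i j * (H ^ t *ᵥ b) j := by
  rw [pow_succ', ← Matrix.mulVec_mulVec]
  rfl

theorem pow_mulVec_nonneg (hH : ∀ i j, 0 ≤ H i j) (hb : ∀ i, 0 ≤ b i) (t : ℕ) (i : Fin n) :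
    0 ≤ (H ^ t *ᵥ b) i := by
  induction t generalizing i with
  | zero => simpa using hb i
  | succ t ih =>
    rw [pow_succ_mulVec_apply]
    exact Finset.sum_nonneg fun j _ => mul_nonneg (hH i j) (ih j)

theorem sum_mul_le_of_row_sum_le (hH : ∀ i j, 0 ≤ H i j) (hsum : ∀ i, ∑ j, H i j ≤ a) {m : ℝ}
    (hm : 0 ≤ m) {v : Fin n → ℝ} (hv : ∀ j, v j ≤ m) (i : Fin n) : ∑ j, H i j * v j ≤ a * m :=
  calc ∑ j, H i j * v j ≤ ∑ j, H i j * m :=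
        Finset.sum_le_sum fun j _ => mul_le_mul_of_nonneg_left (hv j) (hH i j)
    _ = (∑ j, H i j) * m := (Finset.sum_mul _ _ _).symm
    _ ≤ a * m := mul_le_mul_of_nonneg_right (hsum i) hm

theorem pow_mulVec_le (ha : 0 ≤ a) (hH : ∀ i j, 0 ≤ H i j) (hsum : ∀ i, ∑ j, H i j ≤ a)
    (hb1 : ∀ i, b i ≤ 1) (t : ℕ) (i : Fin n) : (H ^ t *ᵥ b) i ≤ a ^ t := by
  induction t generalizing i with
  | zero => simpa using hb1 i
  | succ t ih =>
    rw [pow_succ_mulVec_apply, pow_succ']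
    exact sum_mul_le_of_row_sum_le hH hsum (pow_nonneg ha t) ih i

theorem stoppedWalk_zero_le (hH : ∀ i j, 0 ≤ H i j) (hb : ∀ i, 0 ≤ b i)
    (t : ℕ) (S : Finset (Fin n)) (i : Fin n) :
    stoppedWalk 0 b H t S i ≤ (H ^ t *ᵥ b) i := by
  induction t generalizing S i with
  | zero => simp [stoppedWalk]
  | succ t ih =>
    simp only [stoppedWalk]
    split_ifs
    · exact pow_mulVec_nonneg hH hb (t + 1) i
    · rw [pow_succ_mulVec_apply]
      exact Finset.sum_le_sum fun j _ => mul_le_mul_of_nonneg_left (ih _ j) (hH i j)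

theorem le_stoppedWalk_pow (ha : 0 ≤ a) (hH : ∀ i j, 0 ≤ H i j) (hsum : ∀ i, ∑ j, H i j ≤ a)
    (hb1 : ∀ i, b i ≤ 1) (t : ℕ) (S : Finset (Fin n)) (i : Fin n) :
    (H ^ t *ᵥ b) i ≤ stoppedWalk (fun s => a ^ s) b H t S i := by
  induction t generalizing S i with
  | zero => simp [stoppedWalk]
  | succ t ih =>
    simp only [stoppedWalk]
    split_ifs
    · exact pow_mulVec_le ha hH hsum hb1 (t + 1) i
    · rw [pow_succ_mulVec_apply]
      exact Finset.sum_le_sum fun j _ => mul_le_mul_of_nonneg_left (ih _ j) (hH i j)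

theorem stoppedWalk_sub_le (ha : 0 ≤ a) (hH : ∀ i j, 0 ≤ H i j) (hsum : ∀ i, ∑ j, H i j ≤ a)
    {ε : ℝ} (hε : 0 ≤ ε) (hle : ∀ i j, H i j ≤ a * ε)
    (t : ℕ) (S : Finset (Fin n)) (i : Fin n) :
    stoppedWalk (fun s => a ^ s) b H t S i - stoppedWalk 0 b H t S i
      ≤ a ^ t * (t * (S.card + t) * ε + if i ∈ S then 1 else 0) := by
  induction t generalizing S i with
  | zero =>
    simp only [stoppedWalk, sub_self]
    split_ifs <;> simp
  | succ t ih =>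
    have hat := pow_nonneg ha t
    simp only [stoppedWalk]
    split_ifs with hi
    · have h0 : 0 ≤ ((t + 1 : ℕ) : ℝ) * (S.card + ((t + 1 : ℕ) : ℝ)) * ε := by positivity
      have := mul_nonneg (pow_nonneg ha (t + 1)) h0
      simp only [Pi.zero_apply, sub_zero]
      linarith
    · rw [← Finset.sum_sub_distrib]
      set T := insert i S
      have hT : (T.card : ℝ) = S.card + 1 := by
        rw [Finset.card_insert_of_notMem hi, Nat.cast_add, Nat.cast_one]
      have hind : ∑ j, H i j * (if j ∈ T then (1 : ℝ) else 0) ≤ T.card * (a * ε) := by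
        simp only [mul_ite, mul_one, mul_zero]
        rw [← Finset.sum_filter, Finset.filter_univ_mem, ← nsmul_eq_mul]
        exact Finset.sum_le_card_nsmul _ _ _ fun j _ => hle i j
      have hm : 0 ≤ (t : ℝ) * (T.card + t) * ε := by positivity
      have hconst : ∑ j, H i j * ((t : ℝ) * (T.card + t) * ε) ≤ a * (t * (T.card + t) * ε) :=
        sum_mul_le_of_row_sum_le hH hsum hm (fun _ => le_rfl) i
      calc ∑ j, (H i j * stoppedWalk (fun s => a ^ s) b H t T j - H i j * stoppedWalk 0 b H t T j)
          ≤ ∑ j, a ^ t * (H i j * ((t : ℝ) * (T.card + t) * ε)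
              + H i j * (if j ∈ T then (1 : ℝ) else 0)) := by
            refine Finset.sum_le_sum fun j _ => ?_
            have := mul_le_mul_of_nonneg_left (ih T j) (hH i j)
            linarith
        _ ≤ a ^ t * (a * (t * (T.card + t) * ε) + T.card * (a * ε)) := by
            rw [← Finset.mul_sum, Finset.sum_add_distrib]
            exact mul_le_mul_of_nonneg_left (add_le_add hconst hind) hat
        _ = a ^ (t + 1) * ((t * (S.card + 1 + t) + (S.card + 1)) * ε) := by
            rw [hT]
            ring
        _ ≤ a ^ (t + 1) * (((t + 1 : ℕ) : ℝ) * (S.card + ((t + 1 : ℕ) : ℝ)) * ε + 0) := by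
            refine mul_le_mul_of_nonneg_left ?_ (pow_nonneg ha _)
            rw [add_zero]
            refine mul_le_mul_of_nonneg_right ?_ hε
            push_cast
            have : (0 : ℝ) ≤ t := Nat.cast_nonneg t
            linarith

theorem summable_pow_mulVec (ha : 0 ≤ a) (ha1 : a < 1) (hH : ∀ i j, 0 ≤ H i j)
    (hsum : ∀ i, ∑ j, H i j ≤ a) (hb : ∀ i, 0 ≤ b i) (hb1 : ∀ i, b i ≤ 1) (i : Fin n) :
    Summable fun t => (H ^ t *ᵥ b) i :=
  Summable.of_nonneg_of_le (fun t => pow_mulVec_nonneg hH hb t i)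
    (fun t => pow_mulVec_le ha hH hsum hb1 t i) (summable_geometric_of_lt_one ha ha1)

theorem inv_one_sub_mulVec_eq_tsum (ha : 0 ≤ a) (ha1 : a < 1) (hH : ∀ i j, 0 ≤ H i j)
    (hsum : ∀ i, ∑ j, H i j ≤ a) (hb : ∀ i, 0 ≤ b i) (hb1 : ∀ i, b i ≤ 1) (i : Fin n) :
    ((1 - H)⁻¹ *ᵥ b) i = ∑' t, (H ^ t *ᵥ b) i := by
  have hs := summable_pow_mulVec ha ha1 hH hsum hb hb1
  have hdet : IsUnit (1 - H).det := by
    refine (det_ne_zero_of_sum_row_lt_diag (A := 1 - H) fun k => ?_).isUnit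
    have h1 : ∑ j ∈ Finset.univ.erase k, ‖(1 - H) k j‖ = ∑ j ∈ Finset.univ.erase k, H k j := by
      refine Finset.sum_congr rfl fun j hj => ?_
      rw [Matrix.sub_apply, Matrix.one_apply_ne (Finset.ne_of_mem_erase hj).symm, zero_sub,
        norm_neg, Real.norm_of_nonneg (hH k j)]
    have h2 := Finset.add_sum_erase Finset.univ (H k) (Finset.mem_univ k)
    rw [h1, Matrix.sub_apply, Matrix.one_apply_eq]
    have h3 := hsum k
    have h4 := le_abs_self (1 - H k k)
    rw [← Real.norm_eq_abs] at h4
    linarith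
  have hfix : (1 - H) *ᵥ (fun i => ∑' t, (H ^ t *ᵥ b) i) = b := by
    funext k
    rw [Matrix.sub_mulVec, Matrix.one_mulVec, Pi.sub_apply, (hs k).tsum_eq_zero_add]
    simp only [pow_succ_mulVec_apply]
    rw [Summable.tsum_finsetSum fun j _ => (hs j).mul_left (H k j)]
    simp only [tsum_mul_left, pow_zero, Matrix.one_mulVec]
    simp [Matrix.mulVec, dotProduct]
  conv_lhs => rw [← hfix]
  rw [Matrix.mulVec_mulVec, Matrix.nonsing_inv_mul _ hdet, Matrix.one_mulVec]

theorem dynD_eq (H B : Matrix (Fin n) (Fin n) ℝ) (x : Fin n → ℝ) (t : ℕ) :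
    dynD n H B x t = H ^ t *ᵥ x + ∑ s ∈ Finset.range t, H ^ s *ᵥ (B *ᵥ x) := by
  induction t with
  | zero => simp [dynD]
  | succ t ih =>
    rw [dynD, ih, Finset.sum_range_succ', Matrix.mulVec_add, Matrix.mulVec_mulVec, ← pow_succ',
      Matrix.mulVec_sum]
    simp only [Matrix.mulVec_mulVec, pow_succ', pow_zero, Matrix.one_mul, ← mul_assoc]
    abel

theorem tendsto_dynD (ha : 0 ≤ a) (ha1 : a < 1) (hH : ∀ i j, 0 ≤ H i j)
    (hsum : ∀ i, ∑ j, H i j ≤ a) {B : Matrix (Fin n) (Fin n) ℝ} {x : Fin n → ℝ}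
    (hx : ∀ i, x i ∈ Set.Icc (0 : ℝ) 1) (hBx : ∀ i, (B *ᵥ x) i ∈ Set.Icc (0 : ℝ) 1) :
    Tendsto (fun t => dynD n H B x t) atTop (nhds fun i => ∑' t, (H ^ t *ᵥ (B *ᵥ x)) i) := by
  rw [tendsto_pi_nhds]
  intro i
  simp only [dynD_eq, Pi.add_apply, Finset.sum_apply]
  rw [← zero_add (∑' t, (H ^ t *ᵥ (B *ᵥ x)) i)]
  refine Tendsto.add ?_ ?_
  · exact squeeze_zero (fun t => pow_mulVec_nonneg hH (fun j => (hx j).1) t i)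
      (fun t => pow_mulVec_le ha hH hsum (fun j => (hx j).2) t i)
      (tendsto_pow_atTop_nhds_zero_of_lt_one ha ha1)
  · exact (summable_pow_mulVec ha ha1 hH hsum (fun j => (hBx j).1)
      (fun j => (hBx j).2) i).hasSum.tendsto_sum_nat

end Substochastic

theorem dExp_tsum {n : ℕ} (p : ℝ) {X : ℕ → Finset (Fin n × Fin n) → ℝ}
    (hX : ∀ E, Summable fun t => X t E) :
    HasSum (fun t => dExp n p (X t)) (dExp n p fun E => ∑' t, X t E) :=
  hasSum_sum fun E _ => ((hX E).hasSum.mul_left _)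

theorem abs_dExp_pow_mulVec_sub_le {n : ℕ} (hn : 2 ≤ n) {p : ℝ} (hp : p ∈ Set.Icc (0 : ℝ) 1)
    {α : Fin n → ℝ} {a : ℝ} (ha0 : 0 ≤ a) (hα : ∀ i, 0 ≤ α i) (ha : ∀ i, α i ≤ a)
    {b : Fin n → ℝ} (hb : ∀ i, b i ∈ Set.Icc (0 : ℝ) 1) (t : ℕ) (i : Fin n) :
    |dExp n p (fun E => (HmatD n α E ^ t *ᵥ b) i) - (dExpMat n p (HmatD n α) ^ t *ᵥ b) i|
      ≤ (t : ℝ) ^ 2 * a ^ t * (1 / ((n : ℝ) - 1) + (1 - p) ^ (n - 1)) := by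
  have hHn := dExpMat_HmatD_nonneg hp hα
  have hHs : ∀ i, ∑ j, dExpMat n p (HmatD n α) i j ≤ a := fun i =>
    (sum_dExpMat_HmatD p α i).le.trans (ha i)
  have hn1 : (0 : ℝ) < (n : ℝ) - 1 := by
    have : (2 : ℝ) ≤ n := by exact_mod_cast hn
    linarith
  have hε : 0 ≤ 1 / ((n : ℝ) - 1) + (1 - p) ^ (n - 1) :=
    add_nonneg (by positivity) (pow_nonneg (sub_nonneg.2 hp.2) _)
  have hgap := stoppedWalk_sub_le (b := b) ha0 hHn hHs hε (dExpMat_HmatD_le hn hp hα ha) t ∅ i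
  have hlo := stoppedWalk_zero_le hHn (fun j => (hb j).1) t ∅ i
  have hhi := le_stoppedWalk_pow ha0 hHn hHs (fun j => (hb j).2) t ∅ i
  have hElo : _ ≤ dExp n p (fun E => (HmatD n α E ^ t *ᵥ b) i) := dExp_mono hp fun E =>
    stoppedWalk_zero_le (HmatD_nonneg hα E) (fun j => (hb j).1) t ∅ i
  have hEhi : dExp n p (fun E => (HmatD n α E ^ t *ᵥ b) i) ≤ _ := dExp_mono hp fun E =>
    le_stoppedWalk_pow ha0 (HmatD_nonneg hα E)
      (fun k => (sum_HmatD α E k).le.trans (ha k)) (fun j => (hb j).2) t ∅ i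
  rw [dExp_stoppedWalk] at hElo hEhi
  simp only [Finset.card_empty, Nat.cast_zero, zero_add, Finset.notMem_empty, if_false,
    add_zero] at hgap
  rw [abs_le]
  constructor <;> linarith

theorem abs_dExp_tsum_sub_le {n : ℕ} (hn : 2 ≤ n) {p : ℝ} (hp : p ∈ Set.Icc (0 : ℝ) 1)
    {α : Fin n → ℝ} {a : ℝ} (ha0 : 0 ≤ a) (ha1 : a < 1) (hα : ∀ i, 0 ≤ α i) (ha : ∀ i, α i ≤ a)
    {b : Fin n → ℝ} (hb : ∀ i, b i ∈ Set.Icc (0 : ℝ) 1) (i : Fin n) :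
    |dExp n p (fun E => ∑' t, (HmatD n α E ^ t *ᵥ b) i)
        - ((1 - dExpMat n p (HmatD n α))⁻¹ *ᵥ b) i|
      ≤ (∑' t : ℕ, (t : ℝ) ^ 2 * a ^ t) * (1 / ((n : ℝ) - 1) + (1 - p) ^ (n - 1)) := by
  have hHn := dExpMat_HmatD_nonneg hp hα
  have hHs : ∀ i, ∑ j, dExpMat n p (HmatD n α) i j ≤ a := fun i =>
    (sum_dExpMat_HmatD p α i).le.trans (ha i)
  rw [inv_one_sub_mulVec_eq_tsum ha0 ha1 hHn hHs (fun j => (hb j).1) (fun j => (hb j).2)]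
  have h1 := dExp_tsum p (X := fun t E => (HmatD n α E ^ t *ᵥ b) i) fun E =>
    summable_pow_mulVec ha0 ha1 (HmatD_nonneg hα E) (fun k => (sum_HmatD α E k).le.trans (ha k))
      (fun j => (hb j).1) (fun j => (hb j).2) i
  have h2 := (summable_pow_mulVec ha0 ha1 hHn hHs (fun j => (hb j).1)
    (fun j => (hb j).2) i).hasSum
  have h3 : Summable fun t : ℕ => (t : ℝ) ^ 2 * a ^ t :=
    summable_pow_mul_geometric_of_norm_lt_one 2 (by rwa [Real.norm_of_nonneg ha0])
  rw [← (h1.sub h2).tsum_eq, ← tsum_mul_right, ← Real.norm_eq_abs]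
  exact tsum_of_norm_bounded (h3.mul_right _).hasSum fun t =>
    abs_dExp_pow_mulVec_sub_le hn hp ha0 hα ha hb t i

/-! ### Asymptotics -/

theorem eventually_one_sub_pow_le {p : ℕ → ℝ} (hp : ∀ n, p n ∈ Set.Ioo (0 : ℝ) 1)
    (hreg : Tendsto (fun n : ℕ => p n / (Real.log n ^ 2 / n)) atTop atTop) :
    ∀ᶠ n : ℕ in atTop, (1 - p n) ^ (n - 1) ≤ 1 / (n : ℝ) := by
  filter_upwards [hreg.eventually_ge_atTop 2, eventually_ge_atTop 3] with n h hn
  have hn' : (3 : ℝ) ≤ n := by exact_mod_cast hn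
  have hlog : 1 ≤ Real.log n := by
    rw [Real.le_log_iff_exp_le (by linarith)]
    linarith [Real.exp_one_lt_d9]
  have hpn : 2 * Real.log n ^ 2 ≤ p n * n := by
    rw [le_div_iff₀ (by positivity), ← mul_div_assoc, div_le_iff₀ (by linarith)] at h
    exact h
  have hcast : ((n - 1 : ℕ) : ℝ) = (n : ℝ) - 1 := by
    rw [Nat.cast_sub (by omega), Nat.cast_one]
  have hexp : Real.log n ≤ p n * ((n : ℝ) - 1) := by
    have h0 := (hp n).1
    nlinarith
  calc (1 - p n) ^ (n - 1) ≤ Real.exp (-p n) ^ (n - 1) :=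
        pow_le_pow_left₀ (sub_nonneg.2 (hp n).2.le) (Real.one_sub_le_exp_neg _) _
    _ = Real.exp (-(p n * ((n : ℝ) - 1))) := by
        rw [← Real.exp_nat_mul, hcast]
        ring_nf
    _ ≤ Real.exp (-Real.log n) := Real.exp_le_exp.2 (neg_le_neg hexp)
    _ = 1 / (n : ℝ) := by
        rw [Real.exp_neg, Real.exp_log (by linarith), one_div]

theorem tendsto_lp_norm_of_abs_le_div {ρ : ℝ} (hρ : 1 < ρ) {C : ℝ} (hC : 0 ≤ C)
    {y : (n : ℕ) → Fin n → ℝ} (hy : ∀ᶠ n : ℕ in atTop, ∀ i, |y n i| ≤ C / n) :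
    Tendsto (fun n : ℕ => (∑ i, |y n i| ^ ρ) ^ (1 / ρ)) atTop (nhds 0) := by
  have hρ0 : 0 < ρ := by linarith
  have hlim : Tendsto (fun n : ℕ => C * (n : ℝ) ^ (-(1 - 1 / ρ))) atTop (nhds 0) := by
    rw [← mul_zero C]
    refine Tendsto.const_mul C ?_
    refine (tendsto_rpow_neg_atTop ?_).comp tendsto_natCast_atTop_atTop
    rw [sub_pos, div_lt_one hρ0]
    exact hρ
  refine squeeze_zero' (Eventually.of_forall fun n => by positivity) ?_ hlim
  filter_upwards [hy, eventually_ge_atTop 1] with n hn h1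
  have hn0 : (0 : ℝ) < n := by exact_mod_cast h1
  have hq : 0 ≤ C / n := by positivity
  calc (∑ i, |y n i| ^ ρ) ^ (1 / ρ) ≤ (∑ _i : Fin n, (C / n) ^ ρ) ^ (1 / ρ) := by
        refine Real.rpow_le_rpow (by positivity) ?_ (by positivity)
        exact Finset.sum_le_sum fun i _ => Real.rpow_le_rpow (abs_nonneg _) (hn i) hρ0.le
    _ = (n : ℝ) ^ (1 / ρ) * (C / n) := by
        rw [Finset.sum_const, Finset.card_univ, Fintype.card_fin, nsmul_eq_mul,
          Real.mul_rpow hn0.le (by positivity), ← Real.rpow_mul hq, mul_one_div_cancel hρ0.ne',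
          Real.rpow_one]
    _ = C * (n : ℝ) ^ (-(1 - 1 / ρ)) := by
        rw [neg_sub, Real.rpow_sub hn0, Real.rpow_one]
        ring

/-- **Theorem (mean-field concentration in `ℓ_ρ`, directed model).**
Let `G ∼ D(n,p)` with condescendence parameters `α` and initial opinions
`x0 ∈ [0,1]ⁿ`.  Under the Assumption (there is `ᾱ ∈ (0,1)` with `α n i ≤ ᾱ` for
all `n, i`) and the regime `p ≫ log(n)²/n`, for every `ρ ∈ (1,∞)` the stable
opinion `x(G,∞)` (the limit of the directed opinion dynamics, which exists for
every directed graph) satisfies `‖E(x(G,∞)) − x̄(∞)‖_ρ → 0` as `n → ∞`, where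
`‖y‖_ρ = (Σᵢ |yᵢ|^ρ)^{1/ρ}` and `x̄(∞) = (I − E(H(G)))⁻¹ B x(0)`. -/
theorem mean_field_concentration_directed_lp
    (p : ℕ → ℝ) (hp : ∀ n, p n ∈ Set.Ioo (0 : ℝ) 1)
    (α : (n : ℕ) → Fin n → ℝ) (hα : ∀ n i, α n i ∈ Set.Icc (0 : ℝ) 1)
    (x0 : (n : ℕ) → Fin n → ℝ) (hx0 : ∀ n i, x0 n i ∈ Set.Icc (0 : ℝ) 1)
    (hAssumption : ∃ ᾱ ∈ Set.Ioo (0 : ℝ) 1, ∀ n i, α n i ≤ ᾱ)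
    (hreg : Tendsto (fun n : ℕ => p n / (Real.log n ^ 2 / n)) atTop atTop)
    (ρ : ℝ) (hρ : 1 < ρ) :
    ∃ xInf : (n : ℕ) → Finset (Fin n × Fin n) → Fin n → ℝ,
      (∀ n, ∀ E ∈ (allDirEdges n).powerset,
        Tendsto
          (fun t => dynD n (HmatD n (α n) E) (Matrix.diagonal fun i => 1 - α n i) (x0 n) t)
          atTop (nhds (xInf n E))) ∧
      Tendsto
        (fun n : ℕ =>
          (∑ i : Fin n,
            |dExp n (p n) (fun E => xInf n E i) -
              ((1 - dExpMat n (p n) (HmatD n (α n)))⁻¹ *ᵥ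
                (Matrix.diagonal (fun i => 1 - α n i) *ᵥ x0 n)) i| ^ ρ) ^ (1 / ρ))
        atTop (nhds 0) := by
  obtain ⟨a, ⟨ha0, ha1⟩, ha⟩ := hAssumption
  have hpI : ∀ n, p n ∈ Set.Icc (0 : ℝ) 1 := fun n => Set.Ioo_subset_Icc_self (hp n)
  have hα0 : ∀ n i, 0 ≤ α n i := fun n i => (hα n i).1
  have hb : ∀ n i, (Matrix.diagonal (fun i => 1 - α n i) *ᵥ x0 n) i ∈ Set.Icc (0 : ℝ) 1 := by
    intro n i
    rw [Matrix.mulVec_diagonal]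
    exact unitInterval.mul_mem (Set.Icc.mem_iff_one_sub_mem.1 (hα n i)) (hx0 n i)
  refine ⟨fun n E i => ∑' t,
    (HmatD n (α n) E ^ t *ᵥ (Matrix.diagonal (fun i => 1 - α n i) *ᵥ x0 n)) i, ?_, ?_⟩
  · intro n E _
    exact tendsto_dynD ha0.le ha1 (HmatD_nonneg (hα0 n) E)
      (fun k => (sum_HmatD (α n) E k).le.trans (ha n k)) (hx0 n) (hb n)
  · have hC : 0 ≤ ∑' t : ℕ, (t : ℝ) ^ 2 * a ^ t := tsum_nonneg fun t => by positivity
    refine tendsto_lp_norm_of_abs_le_div hρ (mul_nonneg hC zero_le_three) ?_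
    filter_upwards [eventually_one_sub_pow_le hp hreg, eventually_ge_atTop 2] with n hq hn i
    refine (abs_dExp_tsum_sub_le hn (hpI n) ha0.le ha1 (hα0 n) (ha n) (hb n) i).trans ?_
    rw [mul_div_assoc]
    refine mul_le_mul_of_nonneg_left ?_ hC
    have hn' : (2 : ℝ) ≤ n := by exact_mod_cast hn
    have h1 : 1 / ((n : ℝ) - 1) ≤ 2 / n := by
      rw [div_le_div_iff₀ (by linarith) (by linarith)]
      linarith
    calc 1 / ((n : ℝ) - 1) + (1 - p n) ^ (n - 1) ≤ 2 / n + 1 / n := add_le_add h1 hq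
      _ = 3 / n := by ring
end
end

section
/- Let G ∼ D(n,p) with condescendence parameters α_i ∈ [0,1] and let c = c_1 c_2 ⋯ c_{k+1} be a trail of size k whose first k nodes c_1,…,c_k are pairwise distinct. Then E(∏_{r=1}^k H(G)_{c_r c_{r+1}}) = ∏_{r=1}^k E(H(G)_{c_r c_{r+1}}). -/
open Finset Filter Topology Matrix

attribute [local instance] Classical.propDecidable

noncomputable section

/-- The Bernoulli-weighted sum over the subsets of a disjoint union splits into an iterated sum. -/
theorem sum_powerset_union_bernoulli {ι : Type*} [DecidableEq ι] (a b : ℝ) {s t : Finset ι}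
    (hst : Disjoint s t) (F : Finset ι → ℝ) :
    ∑ E ∈ (s ∪ t).powerset, a ^ E.card * b ^ ((s ∪ t).card - E.card) * F E =
      ∑ U ∈ s.powerset, ∑ V ∈ t.powerset,
        (a ^ U.card * b ^ (s.card - U.card)) * (a ^ V.card * b ^ (t.card - V.card)) *
          F (U ∪ V) := by
  rw [← Finset.sum_product']
  symm
  refine Finset.sum_bij' (fun x _ => x.1 ∪ x.2) (fun E _ => (E ∩ s, E ∩ t)) ?_ ?_ ?_ ?_ ?_
  · rintro ⟨U, V⟩ h
    simp only [Finset.mem_product, Finset.mem_powerset] at h ⊢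
    exact Finset.union_subset_union h.1 h.2
  · intro E _
    simp
  · rintro ⟨U, V⟩ h
    simp only [Finset.mem_product, Finset.mem_powerset] at h
    have hU : Disjoint U t := hst.mono_left h.1
    have hV : Disjoint V s := (hst.mono_right h.2).symm
    ext1
    · simp [Finset.union_inter_distrib_right, Finset.inter_eq_left.mpr h.1,
        Finset.disjoint_iff_inter_eq_empty.mp hV]
    · simp [Finset.union_inter_distrib_right, Finset.inter_eq_left.mpr h.2,
        Finset.disjoint_iff_inter_eq_empty.mp hU]
  · intro E h
    rw [← Finset.inter_union_distrib_left]
    exact Finset.inter_eq_left.mpr (Finset.mem_powerset.mp h)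
  · rintro ⟨U, V⟩ h
    simp only [Finset.mem_product, Finset.mem_powerset] at h
    have hUV : Disjoint U V := hst.mono h.1 h.2
    have h1 := Finset.card_le_card h.1
    have h2 := Finset.card_le_card h.2
    have h3 : s.card + t.card - (U.card + V.card) = (s.card - U.card) + (t.card - V.card) := by
      omega
    rw [Finset.card_union_of_disjoint hUV, Finset.card_union_of_disjoint hst, h3, pow_add, pow_add]
    ring

/-- The expectation is normalized. -/
theorem dExp_one (n : ℕ) (p : ℝ) : dExp n p (fun _ => 1) = 1 := by
  simp [dExp, dProb, Finset.sum_pow_mul_eq_add_pow]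

/-- Random variables determined by complementary sets of edges are uncorrelated. -/
theorem dExp_mul_of_determined (n : ℕ) (p : ℝ) (s : Finset (Fin n × Fin n))
    (X Y : Finset (Fin n × Fin n) → ℝ) (hX : ∀ E, X E = X (E ∩ s)) (hY : ∀ E, Y E = Y (E \ s)) :
    dExp n p (fun E => X E * Y E) = dExp n p X * dExp n p Y := by
  set A := allDirEdges n with hA
  have hd : Disjoint (A ∩ s) (A \ s) :=
    Finset.disjoint_sdiff.mono_left Finset.inter_subset_right
  have hu : (A ∩ s) ∪ (A \ s) = A := by
    ext e
    simp only [Finset.mem_union, Finset.mem_inter, Finset.mem_sdiff]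
    tauto
  have key : ∀ f g : Finset (Fin n × Fin n) → ℝ, (∀ E, f E = f (E ∩ s)) →
      (∀ E, g E = g (E \ s)) → dExp n p (fun E => f E * g E) =
        (∑ U ∈ (A ∩ s).powerset, p ^ U.card * (1 - p) ^ ((A ∩ s).card - U.card) * f U) *
        ∑ V ∈ (A \ s).powerset, p ^ V.card * (1 - p) ^ ((A \ s).card - V.card) * g V := by
    intro f g hf hg
    have h := sum_powerset_union_bernoulli p (1 - p) hd (fun E => f E * g E)
    rw [hu] at h
    unfold dExp dProb
    rw [← hA, h, Finset.sum_mul_sum]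
    refine Finset.sum_congr rfl fun U hU => Finset.sum_congr rfl fun V hV => ?_
    have hU' : U ⊆ s := (Finset.mem_powerset.mp hU).trans Finset.inter_subset_right
    have hV' : Disjoint V s :=
      Finset.sdiff_disjoint.mono_left (Finset.mem_powerset.mp hV)
    have e1 : (U ∪ V) ∩ s = U := by
      rw [Finset.union_inter_distrib_right, Finset.inter_eq_left.mpr hU',
        Finset.disjoint_iff_inter_eq_empty.mp hV', Finset.union_empty]
    have e2 : (U ∪ V) \ s = V := by
      rw [Finset.union_sdiff_distrib, Finset.sdiff_eq_empty_iff_subset.mpr hU',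
        Finset.sdiff_eq_self_of_disjoint hV', Finset.empty_union]
    rw [hf (U ∪ V), hg (U ∪ V), e1, e2]
    ring
  have hXY := key X Y hX hY
  have hX1 := key X (fun _ => 1) hX (fun _ => rfl)
  have h1Y := key (fun _ => 1) Y (fun _ => rfl) hY
  have h11 := key (fun _ => 1) (fun _ => 1) (fun _ => rfl) (fun _ => rfl)
  simp only [mul_one, one_mul] at hX1 h1Y h11
  rw [dExp_one] at h11
  change dExp n p X = _ at hX1
  change dExp n p Y = _ at h1Y
  have cross : ∀ x y u v : ℝ, 1 = u * v → x * y = x * v * (u * y) := fun x y u v h => by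
    linear_combination (x * y) * h
  rw [hXY, hX1, h1Y]
  exact cross _ _ _ _ h11

/-- Expectations of products of random variables determined by pairwise disjoint sets of edges
factorize. -/
theorem dExp_prod_of_determined {κ : Type*} (n : ℕ) (p : ℝ) (S : κ → Finset (Fin n × Fin n))
    (hS : Pairwise fun r q => Disjoint (S r) (S q)) (X : κ → Finset (Fin n × Fin n) → ℝ)
    (hX : ∀ r E, X r E = X r (E ∩ S r)) (R : Finset κ) :
    dExp n p (fun E => ∏ r ∈ R, X r E) = ∏ r ∈ R, dExp n p (X r) := by
  induction R using Finset.induction_on with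
  | empty => simpa using dExp_one n p
  | insert r R hr ih =>
    simp only [Finset.prod_insert hr]
    rw [dExp_mul_of_determined n p (S r) (X r) (fun E => ∏ q ∈ R, X q E) (hX r), ih]
    intro E
    refine Finset.prod_congr rfl fun q hq => ?_
    have hqr : q ≠ r := fun h => hr (h ▸ hq)
    rw [hX q E, hX q (E \ S r)]
    congr 1
    ext e
    have : e ∈ S q → e ∉ S r := fun h => Finset.disjoint_left.mp (hS hqr) h
    simp only [Finset.mem_inter, Finset.mem_sdiff]
    tauto

/-- The `i`-th row of `H(G)` is determined by the edges leaving `i`. -/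
theorem HmatD_inter_out_edges (n : ℕ) (α : Fin n → ℝ) (E : Finset (Fin n × Fin n)) (i j : Fin n) :
    HmatD n α E i j = HmatD n α (E ∩ Finset.univ.filter fun e => e.1 = i) i j := by
  simp [HmatD, degPlus]

/-- **Lemma (factorization of expectations along a directed trail without
repetitions).**  Let `G ∼ D(n,p)` with condescendence parameters
`α i ∈ [0,1]`, and let `c = c₁⋯c_{k+1}` be a trail of size `k` whose first `k`
nodes are pairwise distinct.  Then
`E(∏_{r=1}^k H(G)_{c_r c_{r+1}}) = ∏_{r=1}^k E(H(G)_{c_r c_{r+1}})`. -/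
theorem dExp_trail_factorizes
    (n k : ℕ) (p : ℝ) (hp : p ∈ Set.Ioo (0 : ℝ) 1)
    (α : Fin n → ℝ) (hα : ∀ i, α i ∈ Set.Icc (0 : ℝ) 1)
    (c : Fin (k + 1) → Fin n)
    (hinj : Function.Injective (fun r : Fin k => c r.castSucc)) :
    dExp n p (fun E => ∏ r : Fin k, HmatD n α E (c r.castSucc) (c r.succ)) =
      ∏ r : Fin k, dExp n p (fun E => HmatD n α E (c r.castSucc) (c r.succ)) := by
  exact dExp_prod_of_determined n p
    (fun r : Fin k => Finset.univ.filter fun e : Fin n × Fin n => e.1 = c r.castSucc)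
    (fun r q hrq => by
      refine Finset.disjoint_left.mpr fun e he he' => ?_
      simp only [Finset.mem_filter, Finset.mem_univ, true_and] at he he'
      exact hrq (hinj (he.symm.trans he')))
    (fun r E => HmatD n α E (c r.castSucc) (c r.succ))
    (fun r E => HmatD_inter_out_edges n α E _ _) Finset.univ
end
end

section
/- Let X be a binomial random variable with parameters N ∈ ℕ, N ≥ 1, and p ∈ (0,1), and let m ≥ 1 be an integer. Then E((1/(1+X))^m) ≤ m!/(p^m N^m). -/
noncomputable section

/-- Expectation of `g(X)` for `X ∼ Binomial(N, p)`:
`E(g(X)) = Σ_{t=0}^{N} C(N,t) p^t (1−p)^{N−t} g(t)`. -/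
def binExp (N : ℕ) (p : ℝ) (g : ℕ → ℝ) : ℝ :=
  ∑ t ∈ Finset.range (N + 1), (N.choose t : ℝ) * p ^ t * (1 - p) ^ (N - t) * g t

theorem Nat.ascFactorial_succ_le_factorial_mul_pow (t m : ℕ) :
    (t + 1).ascFactorial m ≤ m.factorial * (t + 1) ^ m := by
  induction m with
  | zero => simp
  | succ k ih =>
    rw [Nat.ascFactorial_succ, Nat.factorial_succ]
    calc (t + 1 + k) * (t + 1).ascFactorial k
        ≤ ((k + 1) * (t + 1)) * (k.factorial * (t + 1) ^ k) :=
          Nat.mul_le_mul (by nlinarith [Nat.zero_le (k * t)]) ih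
      _ = _ := by ring

theorem Nat.choose_mul_ascFactorial_succ {N t : ℕ} (h : t ≤ N) (m : ℕ) :
    N.choose t * (N + 1).ascFactorial m = (N + m).choose (t + m) * (t + 1).ascFactorial m := by
  have h₁ := Nat.choose_mul_factorial_mul_factorial h
  have h₂ := Nat.choose_mul_factorial_mul_factorial (Nat.add_le_add_right h m)
  rw [Nat.add_sub_add_right, ← Nat.factorial_mul_ascFactorial t m,
    ← Nat.factorial_mul_ascFactorial N m, ← h₁] at h₂
  refine Nat.eq_of_mul_eq_mul_right
    (Nat.mul_pos t.factorial_pos (N - t).factorial_pos) ?_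
  linear_combination -h₂

theorem Nat.choose_mul_pow_le {N t : ℕ} (h : t ≤ N) (m : ℕ) :
    N.choose t * N ^ m ≤ m.factorial * (t + 1) ^ m * (N + m).choose (t + m) :=
  calc N.choose t * N ^ m
      ≤ N.choose t * (N + 1).ascFactorial m :=
        Nat.mul_le_mul_left _ ((Nat.pow_le_pow_left N.le_succ m).trans
          (Nat.pow_succ_le_ascFactorial (N + 1) m))
    _ = (N + m).choose (t + m) * (t + 1).ascFactorial m := Nat.choose_mul_ascFactorial_succ h m
    _ ≤ (N + m).choose (t + m) * (m.factorial * (t + 1) ^ m) :=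
        Nat.mul_le_mul_left _ (Nat.ascFactorial_succ_le_factorial_mul_pow t m)
    _ = _ := Nat.mul_comm _ _

/-- An upper tail of a binomial distribution has total mass at most one. -/
theorem sum_choose_add_mul_pow_le_one (N m : ℕ) {p : ℝ} (h₀ : 0 ≤ p) (h₁ : p ≤ 1) :
    ∑ t ∈ Finset.range (N + 1),
      ((N + m).choose (t + m) : ℝ) * p ^ (t + m) * (1 - p) ^ (N - t) ≤ 1 := by
  have hq : 0 ≤ 1 - p := sub_nonneg.2 h₁
  have htotal := add_pow p (1 - p) (N + m)
  rw [add_sub_cancel, one_pow, show N + m + 1 = m + (N + 1) by ring,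
    Finset.sum_range_add] at htotal
  have hhead : 0 ≤ ∑ k ∈ Finset.range m,
      p ^ k * (1 - p) ^ (N + m - k) * ((N + m).choose k : ℝ) :=
    Finset.sum_nonneg fun k _ => by positivity
  have htail : ∑ t ∈ Finset.range (N + 1),
      ((N + m).choose (t + m) : ℝ) * p ^ (t + m) * (1 - p) ^ (N - t) =
      ∑ t ∈ Finset.range (N + 1),
        p ^ (m + t) * (1 - p) ^ (N + m - (m + t)) * ((N + m).choose (m + t) : ℝ) := by
    refine Finset.sum_congr rfl fun t _ => ?_
    rw [add_comm m t, Nat.add_sub_add_right]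
    ring
  linarith

/-- **Lemma (negative moments of the binomial distribution, upper bound).**
Let `X ∼ Binomial(N, p)` with `N ≥ 1` and `p ∈ (0,1)`, and let `m ≥ 1`.  Then
`E((1/(1+X))^m) ≤ m!/(p^m N^m)`. -/
theorem binomial_neg_moment_le
    (N : ℕ) (hN : 1 ≤ N) (p : ℝ) (hp : p ∈ Set.Ioo (0 : ℝ) 1)
    (m : ℕ) (hm : 1 ≤ m) :
    binExp N p (fun t => (1 / (1 + (t : ℝ))) ^ m) ≤
      (Nat.factorial m : ℝ) / (p ^ m * (N : ℝ) ^ m) := by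
  obtain ⟨hp₀, hp₁⟩ := hp
  have hq : 0 < 1 - p := sub_pos.2 hp₁
  have hN₀ : (0 : ℝ) < N := by exact_mod_cast hN
  rw [le_div_iff₀ (by positivity), binExp, Finset.sum_mul]
  calc _ ≤ ∑ t ∈ Finset.range (N + 1), (m.factorial : ℝ) *
        (((N + m).choose (t + m) : ℝ) * p ^ (t + m) * (1 - p) ^ (N - t)) := by
        refine Finset.sum_le_sum fun t ht => ?_
        have hchoose : (N.choose t : ℝ) * (N : ℝ) ^ m ≤
            m.factorial * ((N + m).choose (t + m) : ℝ) * (1 + (t : ℝ)) ^ m := by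
          have h := Nat.choose_mul_pow_le (Finset.mem_range_succ_iff.1 ht) m
          rw [add_comm (1 : ℝ), mul_right_comm]
          exact_mod_cast h
        rw [← div_le_iff₀ (by positivity)] at hchoose
        calc _ = (N.choose t : ℝ) * (N : ℝ) ^ m / (1 + (t : ℝ)) ^ m *
              (p ^ (t + m) * (1 - p) ^ (N - t)) := by
              rw [one_div_pow, pow_add]; ring
          _ ≤ m.factorial * ((N + m).choose (t + m) : ℝ) *
              (p ^ (t + m) * (1 - p) ^ (N - t)) := by gcongr
          _ = _ := by ring
    _ ≤ m.factorial := by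
        rw [← Finset.mul_sum]
        exact mul_le_of_le_one_right (by positivity)
          (sum_choose_add_mul_pow_le_one N m hp₀.le hp₁.le)
end
end

section
/- Let X be a binomial random variable with parameters N ∈ ℕ and p ∈ (0,1), and let m ≥ l ≥ 1 be integers. Then E((1/(l+X))^m) ≤ (m/l)^{m−l}/(p^m (N+1)^m). -/
noncomputable section

theorem Nat.choose_mul_ascFactorial_eq {N t : ℕ} (ht : t ≤ N) (m : ℕ) :
    N.choose t * (N + 1).ascFactorial m =
      (N + m).choose (t + m) * (t + 1).ascFactorial m := by
  have h₁ := Nat.choose_mul_factorial_mul_factorial ht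
  have h₂ := Nat.choose_mul_factorial_mul_factorial (Nat.add_le_add_right ht m)
  rw [Nat.add_sub_add_right, ← Nat.factorial_mul_ascFactorial t m,
    ← Nat.factorial_mul_ascFactorial N m, ← h₁] at h₂
  have hpos : 0 < t.factorial * (N - t).factorial := by positivity
  apply Nat.eq_of_mul_eq_mul_right hpos
  linarith

/-- The inverse rising-factorial moment of a binomial variable, bounded by summing the
binomial theorem for `N + m` over its top `N + 1` terms. -/
theorem binExp_inv_ascFactorial_le (N : ℕ) {p : ℝ} (hp : p ∈ Set.Ioo (0 : ℝ) 1) (m : ℕ) :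
    binExp N p (fun t => 1 / ((t + 1).ascFactorial m : ℝ)) ≤
      1 / (p ^ m * ((N + 1).ascFactorial m : ℝ)) := by
  obtain ⟨hp₀, hp₁⟩ := hp
  have hq : 0 ≤ 1 - p := by linarith
  have hN : (0 : ℝ) < (N + 1).ascFactorial m := by
    exact_mod_cast Nat.ascFactorial_pos N m
  rw [le_div_iff₀ (by positivity), binExp, Finset.sum_mul]
  have hsum : ∑ k ∈ Finset.range (m + (N + 1)),
      p ^ k * (1 - p) ^ (N + m - k) * ((N + m).choose k : ℝ) = 1 := by
    have h := add_pow p (1 - p) (N + m)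
    rw [add_sub_cancel, one_pow] at h
    rw [show m + (N + 1) = N + m + 1 by ring]
    exact h.symm
  rw [Finset.sum_range_add] at hsum
  have hlow : 0 ≤ ∑ k ∈ Finset.range m,
      p ^ k * (1 - p) ^ (N + m - k) * ((N + m).choose k : ℝ) :=
    Finset.sum_nonneg fun _ _ => by positivity
  refine le_of_eq_of_le (Finset.sum_congr rfl fun t ht => ?_)
    (le_of_add_le_of_nonneg_right hsum.le hlow)
  have ht' : t ≤ N := Nat.lt_succ_iff.mp (Finset.mem_range.mp ht)
  have hasc : (0 : ℝ) < (t + 1).ascFactorial m := by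
    exact_mod_cast Nat.ascFactorial_pos t m
  have hch : (N.choose t : ℝ) * (N + 1).ascFactorial m =
      (N + m).choose (t + m) * (t + 1).ascFactorial m := by
    exact_mod_cast Nat.choose_mul_ascFactorial_eq ht' m
  rw [show N + m - (m + t) = N - t by omega, add_comm m t, pow_add]
  field_simp
  linear_combination hch

theorem one_div_add_pow_le_ascFactorial {l m : ℕ} (hl : 1 ≤ l) (hlm : l ≤ m) (t : ℕ) :
    (1 / ((l : ℝ) + t)) ^ m ≤
      ((m : ℝ) / l) ^ (m - l) * (1 / ((t + 1).ascFactorial m : ℝ)) := by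
  have hl' : (0 : ℝ) < l := by exact_mod_cast hl
  have hlm' : (l : ℝ) ≤ m := by exact_mod_cast hlm
  have hasc : (0 : ℝ) < (t + 1).ascFactorial m := by
    exact_mod_cast Nat.ascFactorial_pos t m
  have hnat : (t + 1).ascFactorial m ≤ (t + l) ^ l * (t + m) ^ (m - l) := by
    have h₁ := Nat.ascFactorial_le_pow_add t l
    have h₂ := Nat.ascFactorial_le_pow_add (t + l) (m - l)
    have h₃ := Nat.ascFactorial_mul_ascFactorial (t + 1) l (m - l)
    rw [Nat.add_sub_cancel' hlm, show t + 1 + l = t + l + 1 by ring] at h₃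
    rw [show t + l + (m - l) = t + m by omega] at h₂
    exact h₃ ▸ Nat.mul_le_mul h₁ h₂
  have hreal : ((t + 1).ascFactorial m : ℝ) ≤ ((t : ℝ) + l) ^ l * (t + m) ^ (m - l) := by
    exact_mod_cast hnat
  have hstep : (t : ℝ) + m ≤ m / l * (l + t) := by
    have h : (t : ℝ) ≤ m / l * t :=
      le_mul_of_one_le_left (Nat.cast_nonneg t) ((one_le_div hl').2 hlm')
    rw [mul_add, div_mul_cancel₀ _ hl'.ne']
    linarith
  rw [one_div_pow, mul_one_div, div_le_div_iff₀ (by positivity) hasc, one_mul]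
  calc ((t + 1).ascFactorial m : ℝ) ≤ ((t : ℝ) + l) ^ l * (t + m) ^ (m - l) := hreal
    _ ≤ ((t : ℝ) + l) ^ l * (m / l * (l + t)) ^ (m - l) := by gcongr
    _ = ((m : ℝ) / l) ^ (m - l) * ((l + t) ^ l * (l + t) ^ (m - l)) := by
      rw [mul_pow, add_comm (t : ℝ) l]; ring
    _ = ((m : ℝ) / l) ^ (m - l) * (l + t) ^ m := by
      rw [← pow_add, Nat.add_sub_cancel' hlm]

/-- **Lemma (negative moments of the binomial distribution, shifted upper bound).**
Let `X ∼ Binomial(N, p)` with `p ∈ (0,1)`, and let `m ≥ l ≥ 1` be integers.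
Then `E((1/(l+X))^m) ≤ (m/l)^{m−l}/(p^m (N+1)^m)`. -/
theorem binomial_neg_moment_shift_le
    (N : ℕ) (p : ℝ) (hp : p ∈ Set.Ioo (0 : ℝ) 1)
    (l m : ℕ) (hl : 1 ≤ l) (hlm : l ≤ m) :
    binExp N p (fun t => (1 / ((l : ℝ) + t)) ^ m) ≤
      ((m : ℝ) / (l : ℝ)) ^ (m - l) / (p ^ m * ((N : ℝ) + 1) ^ m) := by
  have hp₀ : 0 < p := hp.1
  have hq : 0 ≤ 1 - p := by linarith [hp.2]
  have hasc : ((N : ℝ) + 1) ^ m ≤ (N + 1).ascFactorial m := by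
    exact_mod_cast Nat.pow_succ_le_ascFactorial (N + 1) m
  calc binExp N p (fun t => (1 / ((l : ℝ) + t)) ^ m)
      ≤ ((m : ℝ) / l) ^ (m - l) *
          binExp N p (fun t => 1 / ((t + 1).ascFactorial m : ℝ)) := by
        rw [binExp, binExp, Finset.mul_sum]
        refine Finset.sum_le_sum fun t _ => ?_
        rw [mul_left_comm]
        exact mul_le_mul_of_nonneg_left (one_div_add_pow_le_ascFactorial hl hlm t)
          (by positivity)
    _ ≤ ((m : ℝ) / l) ^ (m - l) * (1 / (p ^ m * ((N : ℝ) + 1) ^ m)) := by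
        gcongr
        exact (binExp_inv_ascFactorial_le N hp m).trans (by gcongr)
    _ = ((m : ℝ) / l) ^ (m - l) / (p ^ m * ((N : ℝ) + 1) ^ m) := mul_one_div _ _
end
end

section
/- Let n, k ∈ ℕ with k ≥ 2 and let i, j ∈ [n]. The number of sequences c_1, c_2, …, c_{k+1} of elements of [n] with c_1 = i, c_{k+1} = j, and at least one repetition among c_1,…,c_k (i.e., c_a = c_b for some 1 ≤ a < b ≤ k) is at most ((k−1)(k+2)/2) · n^{k−2}. -/
open Finset

attribute [local instance] Classical.propDecidable

/-- A family of functions that is determined by its values on `T` has at most `|β| ^ |T|` members. -/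
theorem card_le_pow_card_of_eqOn_imp_eq {α β : Type*} [Fintype β] (S : Finset (α → β))
    (T : Finset α) (h : ∀ c ∈ S, ∀ d ∈ S, (∀ x ∈ T, c x = d x) → c = d) :
    S.card ≤ Fintype.card β ^ T.card := by
  have hcard : (univ : Finset (T → β)).card = Fintype.card β ^ T.card := by simp
  rw [← hcard]
  refine card_le_card_of_injOn (fun c x => c x.1) (fun _ _ => mem_coe.2 (mem_univ _)) ?_
  intro c hc d hd hcd
  exact h c hc d hd fun x hx => congrFun hcd ⟨x, hx⟩

/-- Prescribing both endpoints and one coincidence among the first `k` positions leaves at most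
`k - 2` free positions. -/
theorem card_filter_endpoints_eq_and_coincidence_le {n k : ℕ} (i j : Fin n) {a b : Fin k}
    (hab : a < b) :
    (univ.filter fun c : Fin (k + 1) → Fin n =>
        c 0 = i ∧ c (Fin.last k) = j ∧ c a.castSucc = c b.castSucc).card ≤ n ^ (k - 2) := by
  have hab' : a.val < b.val := hab
  have hb := b.isLt
  have hfixed : ({0, Fin.last k, b.castSucc} : Finset (Fin (k + 1))).card = 3 := by
    rw [card_eq_three]
    refine ⟨_, _, _, ?_, ?_, ?_, rfl⟩ <;> simp only [ne_eq, Fin.ext_iff, Fin.val_zero,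
      Fin.val_last, Fin.val_castSucc] <;> omega
  have hfree : (({0, Fin.last k, b.castSucc} : Finset (Fin (k + 1)))ᶜ).card = k - 2 := by
    rw [card_compl, hfixed, Fintype.card_fin]
    omega
  have hmain := card_le_pow_card_of_eqOn_imp_eq
    (univ.filter fun c : Fin (k + 1) → Fin n =>
        c 0 = i ∧ c (Fin.last k) = j ∧ c a.castSucc = c b.castSucc)
    ({0, Fin.last k, b.castSucc} : Finset (Fin (k + 1)))ᶜ ?_
  · rwa [hfree, Fintype.card_fin] at hmain
  · intro c hc d hd hcd
    obtain ⟨hc0, hcl, hcab⟩ := (mem_filter.1 hc).2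
    obtain ⟨hd0, hdl, hdab⟩ := (mem_filter.1 hd).2
    have hne : ∀ x, x ≠ b.castSucc → c x = d x := by
      intro x hxb
      by_cases hx0 : x = 0
      · rw [hx0, hc0, hd0]
      by_cases hxl : x = Fin.last k
      · rw [hxl, hcl, hdl]
      exact hcd x (by simp [hx0, hxl, hxb])
    funext x
    by_cases hxb : x = b.castSucc
    · rw [hxb, ← hcab, ← hdab]
      exact hne _ fun h => hab.ne (Fin.castSucc_injective k h)
    · exact hne x hxb

/-- Union bound over all pairs of positions that may coincide. -/
theorem card_filter_endpoints_eq_and_not_injective_le (n k : ℕ) (i j : Fin n) :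
    (univ.filter fun c : Fin (k + 1) → Fin n =>
        c 0 = i ∧ c (Fin.last k) = j ∧
          ¬ Function.Injective fun r : Fin k => c r.castSucc).card ≤
      (k * (k - 1) / 2) * n ^ (k - 2) := by
  have hsub : (univ.filter fun c : Fin (k + 1) → Fin n =>
        c 0 = i ∧ c (Fin.last k) = j ∧
          ¬ Function.Injective fun r : Fin k => c r.castSucc) ⊆
      univ.biUnion fun b : Fin k => (Iio b).biUnion fun a =>
        univ.filter fun c : Fin (k + 1) → Fin n =>
          c 0 = i ∧ c (Fin.last k) = j ∧ c a.castSucc = c b.castSucc := by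
    intro c hc
    obtain ⟨h0, hl, hinj⟩ := (mem_filter.1 hc).2
    simp only [Function.Injective, not_forall] at hinj
    obtain ⟨a, b, heq, hne⟩ := hinj
    simp only [mem_biUnion, mem_univ, mem_Iio, mem_filter, true_and]
    rcases lt_or_gt_of_ne hne with h | h
    · exact ⟨b, a, h, h0, hl, heq⟩
    · exact ⟨a, b, h, h0, hl, heq.symm⟩
  calc _ ≤ _ := card_le_card hsub
    _ ≤ ∑ b : Fin k, b.val * n ^ (k - 2) := by
        refine card_biUnion_le.trans (sum_le_sum fun b _ => ?_)
        refine (card_biUnion_le_card_mul _ _ (n ^ (k - 2)) fun a ha =>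
          card_filter_endpoints_eq_and_coincidence_le i j (mem_Iio.1 ha)).trans ?_
        rw [Fin.card_Iio]
    _ = (k * (k - 1) / 2) * n ^ (k - 2) := by
        rw [← sum_mul, Fin.sum_univ_eq_sum_range (fun b => b), sum_range_id]

/-- **Lemma (counting trails with a repetition among their first `k` nodes).**
Let `k ≥ 2` and `i, j ∈ [n]`.  The number of sequences `c₁,…,c_{k+1}` of
elements of `[n]` (encoded as `c : Fin (k+1) → Fin n`) with `c₁ = i`,
`c_{k+1} = j`, and at least one repetition among `c₁,…,c_k` (i.e. the map
`r ↦ c_r` on the first `k` positions is not injective) is at most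
`((k−1)(k+2)/2) n^{k−2}`. -/
theorem count_trails_with_repetition_le
    (n k : ℕ) (hk : 2 ≤ k) (i j : Fin n) :
    ((Finset.univ.filter fun c : Fin (k + 1) → Fin n =>
        c 0 = i ∧ c (Fin.last k) = j ∧
          ¬ Function.Injective fun r : Fin k => c r.castSucc).card : ℝ) ≤
      ((k : ℝ) - 1) * ((k : ℝ) + 2) / 2 * (n : ℝ) ^ (k - 2) := by
  have hcount : ((k * (k - 1) / 2 : ℕ) : ℝ) ≤ ((k : ℝ) - 1) * ((k : ℝ) + 2) / 2 := by
    have hk' : (2 : ℝ) ≤ k := by exact_mod_cast hk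
    have hdiv : ((k * (k - 1) / 2 : ℕ) : ℝ) ≤ ((k * (k - 1) : ℕ) : ℝ) / 2 := Nat.cast_div_le
    rw [Nat.cast_mul, Nat.cast_pred (by omega)] at hdiv
    nlinarith
  have hcard := card_filter_endpoints_eq_and_not_injective_le n k i j
  refine (Nat.cast_le (α := ℝ).2 hcard).trans ?_
  rw [Nat.cast_mul, Nat.cast_pow]
  gcongr
end
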